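/- For every nonempty H = {h_1 < ⋯ < h_d} ⊆ {1, …, r} and every L ⊆ {1, …, r}, the identity C_H·C_L = Σ_{s=1}^{d} y_{h_s}·b_{H_s∩L}·C_{H_s△L} holds in C, where H_s := H ∖ {h_s} and △ denotes symmetric difference. In particular, the product of any two elements of Im δ again lies in Im δ. -/

import Mathlib

/-!
Context: `p = 2`, `r ≥ 1`, `k : Fin r → ℕ` with `k i ≥ 1`, and elements `b_1,…,b_r ∈ A`
(given by lifts `btil i ∈ 𝔽₂[y_1,…,y_r]`).  The Koszul complex `C`, endowed with the
algebra structure `θ_i² = b_i`, is the commutative `𝔽₂`-algebra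
`C = 𝔽₂[y_1,…,y_r,θ_1,…,θ_r]/⟨y_i^{k_i}, θ_i² − b_i⟩`;
here the variables `Sum.inl i` play the role of `y_i` and `Sum.inr i` that of `θ_i`.
In it, `θ_I = Π_{i∈I} θ_i`, `A` is the image of `𝔽₂[y_1,…,y_r]`,
`C_I := δ(θ_I) = Σ_{s=1}^{|I|} (−1)^{s−1} y_{i_s} θ_{I∖{i_s}}`, and
`Im δ` is the `A`-span of the `C_I`'s.
-/

set_option synthInstance.maxHeartbeats 1000000
set_option maxHeartbeats 1000000

noncomputable section

open MvPolynomial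

/-- The Koszul complex with its algebra structure:
`C = 𝔽₂[y_1,…,y_r,θ_1,…,θ_r]/⟨y_i^{k_i}, θ_i² − b_i : 1 ≤ i ≤ r⟩`. -/
abbrev KRing (r : ℕ) (k : Fin r → ℕ) (btil : Fin r → MvPolynomial (Fin r) (ZMod 2)) : Type :=
  MvPolynomial (Fin r ⊕ Fin r) (ZMod 2) ⧸
    Ideal.span
      ((Set.range fun i : Fin r =>
          (X (Sum.inl i) : MvPolynomial (Fin r ⊕ Fin r) (ZMod 2)) ^ k i) ∪
       (Set.range fun i : Fin r =>
          (X (Sum.inr i) : MvPolynomial (Fin r ⊕ Fin r) (ZMod 2)) ^ 2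
            - rename Sum.inl (btil i)))

variable (r : ℕ) (k : Fin r → ℕ) (btil : Fin r → MvPolynomial (Fin r) (ZMod 2))

/-- The element `y_i ∈ A ⊆ C`. -/
def ky (i : Fin r) : KRing r k btil := Ideal.Quotient.mk _ (X (Sum.inl i))

/-- The element `θ_i ∈ C`. -/
def kth (i : Fin r) : KRing r k btil := Ideal.Quotient.mk _ (X (Sum.inr i))

/-- The map `𝔽₂[Y_1,…,Y_r] → C`, `Y_i ↦ y_i`; its image is the subring `A ⊆ C`. -/
def yEval (q : MvPolynomial (Fin r) (ZMod 2)) : KRing r k btil :=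
  Ideal.Quotient.mk _ (rename Sum.inl q)

/-- The element `b_i = θ_i² ∈ A`. -/
def kb (i : Fin r) : KRing r k btil := yEval r k btil (btil i)

/-- `b_M := Π_{i∈M} b_i` (with `b_∅ = 1`). -/
def kbM (M : Finset (Fin r)) : KRing r k btil := ∏ i ∈ M, kb r k btil i

/-- The element `θ_I = Π_{i∈I} θ_i` (with `θ_∅ = 1`). -/
def kTheta (I : Finset (Fin r)) : KRing r k btil := ∏ i ∈ I, kth r k btil i

/-- The element `C_I := δ(θ_I) = Σ_{s=1}^{|I|} (−1)^{s−1} y_{i_s}·θ_{I∖{i_s}}`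
(so `C_∅ = 0` and `C_{{i}} = y_i`). -/
def kC (I : Finset (Fin r)) : KRing r k btil :=
  ∑ i ∈ I, (-1 : KRing r k btil) ^ (I.filter fun j => j < i).card *
    (ky r k btil i * kTheta r k btil (I.erase i))

/-- `Im δ ⊆ C`: the image of the Koszul differential, i.e. the `A`-span of the `C_I`'s. -/
def kIm : Submodule (ZMod 2) (KRing r k btil) :=
  Submodule.span (ZMod 2)
    {x : KRing r k btil | ∃ (q : MvPolynomial (Fin r) (ZMod 2)) (I : Finset (Fin r)),
      x = yEval r k btil q * kC r k btil I}

/-- `θ_S·θ_T = b_{S∩T}·θ_{S△T}` in any commutative ring with `θ_i² = b_i`. -/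
theorem prod_mul_prod_eq_inter_symmDiff {ι R : Type*} [Fintype ι] [DecidableEq ι] [CommRing R]
    {t b : ι → R} (ht : ∀ i, t i * t i = b i) (S T : Finset ι) :
    (∏ i ∈ S, t i) * ∏ i ∈ T, t i = (∏ i ∈ S ∩ T, b i) * ∏ i ∈ symmDiff S T, t i := by
  have key : ∀ (f : ι → R) (U : Finset ι), ∏ i ∈ U, f i = ∏ i, if i ∈ U then f i else 1 := by
    intro f U
    simp
  rw [key t S, key t T, key b, key t (symmDiff S T), ← Finset.prod_mul_distrib,
    ← Finset.prod_mul_distrib]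
  refine Finset.prod_congr rfl fun i _ => ?_
  by_cases h1 : i ∈ S <;> by_cases h2 : i ∈ T <;> simp [h1, h2, Finset.mem_symmDiff, ht]

/-- The Koszul differential of `θ_S`, with signs omitted. -/
def unsignedKoszul {ι R : Type*} [DecidableEq ι] [CommRing R] (y t : ι → R) (S : Finset ι) : R :=
  ∑ i ∈ S, y i * ∏ j ∈ S.erase i, t j

theorem unsignedKoszul_leibniz {ι R : Type*} [Fintype ι] [DecidableEq ι] [CommRing R]
    (h2 : (2 : R) = 0) {y t b : ι → R} (ht : ∀ i, t i * t i = b i) (S T : Finset ι) :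
    (∏ i ∈ S ∩ T, b i) * unsignedKoszul y t (symmDiff S T) =
      unsignedKoszul y t S * (∏ i ∈ T, t i) + (∏ i ∈ S, t i) * unsignedKoszul y t T := by
  have key : ∀ U : Finset ι, unsignedKoszul y t U =
      ∑ i, if i ∈ U then y i * ∏ j ∈ U.erase i, t j else 0 := by
    intro U
    simp [unsignedKoszul]
  simp only [key, Finset.mul_sum, Finset.sum_mul, ← Finset.sum_add_distrib]
  refine Finset.sum_congr rfl fun i _ => ?_
  by_cases hS : i ∈ S <;> by_cases hT : i ∈ T
  · simp only [hS, hT, Finset.mem_symmDiff, if_true, not_true, and_false, or_false, if_false,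
      mul_zero]
    rw [← Finset.mul_prod_erase S t hS, ← Finset.mul_prod_erase T t hT]
    linear_combination
      (-(y i * t i * (∏ j ∈ S.erase i, t j) * ∏ j ∈ T.erase i, t j)) * h2
  · have h := prod_mul_prod_eq_inter_symmDiff ht (S.erase i) T
    have e1 : S.erase i ∩ T = S ∩ T := by grind
    have e2 : symmDiff (S.erase i) T = (symmDiff S T).erase i := by
      ext j; simp only [Finset.mem_symmDiff, Finset.mem_erase]; grind
    rw [e1, e2] at h
    simp only [hS, hT, Finset.mem_symmDiff, if_true, not_false_eq_true, and_self, true_or,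
      if_false, mul_zero, add_zero]
    linear_combination (-y i) * h
  · have h := prod_mul_prod_eq_inter_symmDiff ht S (T.erase i)
    have e1 : S ∩ T.erase i = S ∩ T := by grind
    have e2 : symmDiff S (T.erase i) = (symmDiff S T).erase i := by
      ext j; simp only [Finset.mem_symmDiff, Finset.mem_erase]; grind
    rw [e1, e2] at h
    simp only [hS, hT, Finset.mem_symmDiff, if_true, not_false_eq_true, and_self, or_true,
      if_false, zero_mul, zero_add]
    linear_combination (-y i) * h
  · simp [hS, hT, Finset.mem_symmDiff]

theorem sum_mul_unsignedKoszul_erase {ι R : Type*} [DecidableEq ι] [CommRing R]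
    (h2 : (2 : R) = 0) (y t : ι → R) (H : Finset ι) :
    ∑ i ∈ H, y i * unsignedKoszul y t (H.erase i) = 0 := by
  simp only [unsignedKoszul, Finset.mul_sum]
  rw [Finset.sum_sigma']
  refine Finset.sum_involution (fun p _ => ⟨p.2, p.1⟩) ?_ ?_ ?_ ?_
  · rintro ⟨i, j⟩ _
    dsimp only
    rw [Finset.erase_right_comm]
    linear_combination (y i * y j * ∏ l ∈ (H.erase j).erase i, t l) * h2
  · rintro ⟨i, j⟩ hp _ heq
    simp only [Finset.mem_sigma, Finset.mem_erase] at hp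
    simp only [Sigma.mk.injEq] at heq
    exact hp.2.1 heq.1
  · rintro ⟨i, j⟩ hp
    simp only [Finset.mem_sigma, Finset.mem_erase] at hp ⊢
    exact ⟨hp.2.2, hp.2.1.symm, hp.1⟩
  · rintro ⟨i, j⟩ _
    rfl

theorem unsignedKoszul_mul {ι R : Type*} [Fintype ι] [DecidableEq ι] [CommRing R]
    (h2 : (2 : R) = 0) {y t b : ι → R} (ht : ∀ i, t i * t i = b i) (H L : Finset ι) :
    unsignedKoszul y t H * unsignedKoszul y t L =
      ∑ i ∈ H, y i * (∏ j ∈ H.erase i ∩ L, b j) *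
        unsignedKoszul y t (symmDiff (H.erase i) L) := by
  simp only [mul_assoc, unsignedKoszul_leibniz h2 ht, mul_add, Finset.sum_add_distrib]
  simp only [← mul_assoc, ← Finset.sum_mul]
  rw [sum_mul_unsignedKoszul_erase h2, zero_mul, zero_add, unsignedKoszul]

theorem KRing.two_eq_zero : (2 : KRing r k btil) = 0 := by
  have h : algebraMap (ZMod 2) (KRing r k btil) 2 = 0 := by
    rw [show (2 : ZMod 2) = 0 from rfl, map_zero]
  rwa [map_ofNat] at h

theorem kth_mul_self (i : Fin r) : kth r k btil i * kth r k btil i = kb r k btil i := by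
  rw [kth, kb, yEval, ← map_mul, ← sq]
  exact Ideal.Quotient.eq.2 (Ideal.subset_span (Or.inr ⟨i, rfl⟩))

theorem kC_eq_unsignedKoszul (I : Finset (Fin r)) :
    kC r k btil I = unsignedKoszul (ky r k btil) (kth r k btil) I := by
  have h : (-1 : KRing r k btil) = 1 := by
    linear_combination -KRing.two_eq_zero r k btil
  simp only [kC, unsignedKoszul, kTheta, h, one_pow, one_mul]

theorem kC_mul_kC (H L : Finset (Fin r)) :
    kC r k btil H * kC r k btil L =
      ∑ i ∈ H, ky r k btil i * kbM r k btil ((H.erase i) ∩ L) *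
        kC r k btil (symmDiff (H.erase i) L) := by
  simp only [kC_eq_unsignedKoszul, kbM]
  exact unsignedKoszul_mul (KRing.two_eq_zero r k btil) (kth_mul_self r k btil) H L

theorem yEval_mul (p q : MvPolynomial (Fin r) (ZMod 2)) :
    yEval r k btil (p * q) = yEval r k btil p * yEval r k btil q := by
  simp only [yEval, map_mul]

theorem yEval_X (i : Fin r) : yEval r k btil (X i) = ky r k btil i := by
  simp only [yEval, ky, rename_X]

theorem yEval_prod_btil (M : Finset (Fin r)) :
    yEval r k btil (∏ i ∈ M, btil i) = kbM r k btil M := by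
  simp only [yEval, kbM, kb, map_prod]

theorem yEval_mul_kC_mul_mem_kIm (p q : MvPolynomial (Fin r) (ZMod 2)) (I J : Finset (Fin r)) :
    yEval r k btil p * kC r k btil I * (yEval r k btil q * kC r k btil J) ∈ kIm r k btil := by
  rw [mul_mul_mul_comm, kC_mul_kC, Finset.mul_sum]
  refine Submodule.sum_mem _ fun i _ => Submodule.subset_span
    ⟨p * q * (X i * ∏ j ∈ I.erase i ∩ J, btil j), symmDiff (I.erase i) J, ?_⟩
  simp only [yEval_mul, yEval_X, yEval_prod_btil, mul_assoc]

theorem mul_mem_kIm {x y : KRing r k btil} (hx : x ∈ kIm r k btil) (hy : y ∈ kIm r k btil) :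
    x * y ∈ kIm r k btil := by
  have h : kIm r k btil * kIm r k btil ≤ kIm r k btil := by
    rw [kIm, Submodule.span_mul_span, Submodule.span_le]
    rintro _ ⟨_, ⟨p, I, rfl⟩, _, ⟨q, J, rfl⟩, rfl⟩
    exact yEval_mul_kC_mul_mem_kIm r k btil p q I J
  exact h (Submodule.mul_mem_mul hx hy)

/-- For every nonempty `H = {h_1 < ⋯ < h_d} ⊆ {1,…,r}` and every
`L ⊆ {1,…,r}`, the identity `C_H·C_L = Σ_{s=1}^{d} y_{h_s}·b_{H_s∩L}·C_{H_s△L}` holds in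
`C`, where `H_s := H ∖ {h_s}` and `△` denotes symmetric difference.  In particular, the
product of any two elements of `Im δ` again lies in `Im δ`. -/
theorem statement5 (r : ℕ) (hr : 1 ≤ r) (k : Fin r → ℕ) (hk : ∀ i, 1 ≤ k i)
    (btil : Fin r → MvPolynomial (Fin r) (ZMod 2)) :
    (∀ H L : Finset (Fin r), H.Nonempty →
      kC r k btil H * kC r k btil L =
        ∑ i ∈ H, ky r k btil i * kbM r k btil ((H.erase i) ∩ L) *
          kC r k btil (symmDiff (H.erase i) L)) ∧
    (∀ x ∈ kIm r k btil, ∀ y ∈ kIm r k btil, x * y ∈ kIm r k btil) := by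
  exact ⟨fun H L _ => kC_mul_kC r k btil H L,
    fun _ hx _ hy => mul_mem_kIm r k btil hx hy⟩

end
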